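/- arXiv:0811.2277 — 2 statements merged into one kernel-verified Lean document; each statement's English description precedes it below -/
import Mathlib

section
/- Let Ω ⊆ ℍ be open and H-convex, u : Ω → ℝ be H-convex, and g ∈ Ω. Then the two-sided limits Xu(g) = lim_{λ→0} (u(g·(λ,0,0)) − u(g))/λ and Yu(g) = lim_{λ→0} (u(g·(0,λ,0)) − u(g))/λ both exist if and only if ∂_H u(g) is a singleton; moreover, in either case ∂_H u(g) = {(Xu(g), Yu(g))}. -/
noncomputable section

open Filter Topology Set
open scoped ENNReal

/-- The underlying set of the Heisenberg group `ℍ = ℝ³`, points `(x, y, t)`. -/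
abbrev Hgrp : Type := ℝ × ℝ × ℝ

/-- Heisenberg group law `(x,y,t)·(x',y',t') = (x+x', y+y', t+t'+2(x'y−xy'))`. -/
def hmul (g g' : Hgrp) : Hgrp :=
  (g.1 + g'.1, g.2.1 + g'.2.1,
    g.2.2 + g'.2.2 + 2 * (g'.1 * g.2.1 - g.1 * g'.2.1))

/-- Inverse in the Heisenberg group. -/
def hinv (g : Hgrp) : Hgrp := (-g.1, -g.2.1, -g.2.2)

/-- Anisotropic dilation `δ_λ(x,y,t) = (λx, λy, λ²t)`. -/
def hdil (l : ℝ) (g : Hgrp) : Hgrp := (l * g.1, l * g.2.1, l ^ 2 * g.2.2)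

/-- Horizontal projection `ξ₁(x,y,t) = (x,y)`. -/
def xi1 (g : Hgrp) : ℝ × ℝ := (g.1, g.2.1)

/-- Exponential of a horizontal vector: `exp (a,b) = (a,b,0)`. -/
def hexp (v : ℝ × ℝ) : Hgrp := (v.1, v.2, 0)

/-- Euclidean inner product on `ℝ²`. -/
def dot (p q : ℝ × ℝ) : ℝ := p.1 * q.1 + p.2 * q.2

/-- Euclidean norm on `ℝ²`. -/
def enorm2 (p : ℝ × ℝ) : ℝ := Real.sqrt (p.1 ^ 2 + p.2 ^ 2)

/-- The horizontal plane `H_{g₀} = {(x,y,t) : t = t₀ + 2y₀x − 2x₀y}`. -/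
def hplane (g0 : Hgrp) : Set Hgrp :=
  {g | g.2.2 = g0.2.2 + 2 * g0.2.1 * g.1 - 2 * g0.1 * g.2.1}

/-- The H-subdifferential `∂_H u(g₀)` of `u : Ω → ℝ` at `g₀`. -/
def hsub (Ω : Set Hgrp) (u : Hgrp → ℝ) (g0 : Hgrp) : Set (ℝ × ℝ) :=
  {p | ∀ g ∈ hplane g0 ∩ Ω, u g ≥ u g0 + dot p (xi1 g - xi1 g0)}

/-- The H-normal map: `∂_H u(E) = ⋃_{g ∈ E} ∂_H u(g)`. -/
def hsubSet (Ω : Set Hgrp) (u : Hgrp → ℝ) (E : Set Hgrp) : Set (ℝ × ℝ) :=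
  ⋃ g ∈ E, hsub Ω u g

/-- H-convexity of a set. -/
def HConvexSet (Ω : Set Hgrp) : Prop :=
  ∀ g ∈ Ω, ∀ g' ∈ hplane g ∩ Ω, ∀ l ∈ Set.Icc (0:ℝ) 1,
    hmul g (hdil l (hmul (hinv g) g')) ∈ Ω

/-- H-convexity (weak H-convexity) of a function on `Ω`. -/
def HConvexOn (Ω : Set Hgrp) (u : Hgrp → ℝ) : Prop :=
  ∀ g ∈ Ω, ∀ g' ∈ hplane g ∩ Ω, ∀ l ∈ Set.Icc (0:ℝ) 1,
    u (hmul g (hdil l (hmul (hinv g) g'))) ≤ u g + l * (u g' - u g)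

/-- Strict H-convexity of a function on all of `ℍ`. -/
def StrictHConvexOn (u : Hgrp → ℝ) : Prop :=
  HConvexOn Set.univ u ∧
    ∀ g : Hgrp, ∀ g' ∈ hplane g, g ≠ g' → ∀ l ∈ Set.Icc (0:ℝ) 1,
      u (hmul g (hdil l (hmul (hinv g) g'))) = u g + l * (u g' - u g) →
        l = 0 ∨ l = 1

/-- The Korányi gauge `‖(x,y,t)‖_ℍ = ((x²+y²)² + t²)^{1/4}`. -/
def kgauge (g : Hgrp) : ℝ := ((g.1 ^ 2 + g.2.1 ^ 2) ^ 2 + g.2.2 ^ 2) ^ ((1:ℝ)/4)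

/-- The Korányi distance `ρ(g,g') = ‖g⁻¹·g'‖_ℍ`. -/
def kdist (g g' : Hgrp) : ℝ := kgauge (hmul (hinv g) g')

/-- A function on `ℍ` is radial if `u(x,y,t) = U(√(x²+y²), t)`. -/
def IsRadial (u : Hgrp → ℝ) : Prop :=
  ∃ U : ℝ × ℝ → ℝ, ∀ x y t : ℝ, u (x, y, t) = U (Real.sqrt (x ^ 2 + y ^ 2), t)

/-- Horizontal derivative `Xu = ∂u/∂x + 2y ∂u/∂t`. -/
def Xd (u : Hgrp → ℝ) (g : Hgrp) : ℝ :=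
  fderiv ℝ u g (1, 0, 0) + 2 * g.2.1 * fderiv ℝ u g (0, 0, 1)

/-- Horizontal derivative `Yu = ∂u/∂y − 2x ∂u/∂t`. -/
def Yd (u : Hgrp → ℝ) (g : Hgrp) : ℝ :=
  fderiv ℝ u g (0, 1, 0) - 2 * g.1 * fderiv ℝ u g (0, 0, 1)

/-- Difference quotient of `u` at `g` in the `X` direction. -/
def XdiffQuot (u : Hgrp → ℝ) (g : Hgrp) (l : ℝ) : ℝ := (u (hmul g (l, 0, 0)) - u g) / l

/-- Difference quotient of `u` at `g` in the `Y` direction. -/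
def YdiffQuot (u : Hgrp → ℝ) (g : Hgrp) (l : ℝ) : ℝ := (u (hmul g (0, l, 0)) - u g) / l

/-- Existence of the two-sided limit `Xu(g)`. -/
def XlimExists (u : Hgrp → ℝ) (g : Hgrp) : Prop :=
  ∃ a : ℝ, Filter.Tendsto (XdiffQuot u g) (nhdsWithin 0 {0}ᶜ) (nhds a)

/-- Existence of the two-sided limit `Yu(g)`. -/
def YlimExists (u : Hgrp → ℝ) (g : Hgrp) : Prop :=
  ∃ a : ℝ, Filter.Tendsto (YdiffQuot u g) (nhdsWithin 0 {0}ᶜ) (nhds a)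

/-- The value `Xu(g)` (defined via choice where the limit exists, else `0`). -/
def XuVal (u : Hgrp → ℝ) (g : Hgrp) : ℝ :=
  haveI := Classical.dec (XlimExists u g)
  if h : XlimExists u g then h.choose else 0

/-- The value `Yu(g)`. -/
def YuVal (u : Hgrp → ℝ) (g : Hgrp) : ℝ :=
  haveI := Classical.dec (YlimExists u g)
  if h : YlimExists u g then h.choose else 0

/-- The horizontal gradient `𝕏u(g) = (Xu(g), Yu(g))`. -/
def XXgrad (u : Hgrp → ℝ) (g : Hgrp) : ℝ × ℝ := (XuVal u g, YuVal u g)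

/-- The circle `C(t,R) = {(x,y,t) : x²+y² = R²}`. -/
def Ccirc (t R : ℝ) : Set Hgrp := {g | g.2.2 = t ∧ g.1 ^ 2 + g.2.1 ^ 2 = R ^ 2}

/-- A disc (open or closed) in `ℝ²` centered at the origin, of radius `R ∈ [0,∞]`. -/
def IsCenteredDisc (S : Set (ℝ × ℝ)) : Prop :=
  ∃ R : ℝ≥0∞, S = {p : ℝ × ℝ | ENNReal.ofReal (enorm2 p) < R} ∨
    S = {p : ℝ × ℝ | ENNReal.ofReal (enorm2 p) ≤ R}

/-- Diameter of a subset of `ℍ` with respect to the Korányi distance. -/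
def kdiam (S : Set Hgrp) : ℝ≥0∞ :=
  ⨆ a ∈ S, ⨆ b ∈ S, ENNReal.ofReal (kdist a b)

/-- The 2-dimensional Hausdorff (outer) measure of the metric space `(ℍ, ρ)`. -/
def kHaus2 (S : Set Hgrp) : ℝ≥0∞ :=
  ⨆ (ε : ℝ≥0∞) (_ : 0 < ε),
    ⨅ (c : ℕ → Set Hgrp) (_ : S ⊆ ⋃ n, c n) (_ : ∀ n, kdiam (c n) ≤ ε),
      ∑' n, (kdiam (c n)) ^ 2

/-- The set `D` of points of `Ω` where both horizontal derivatives exist. -/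
def Dset (Ω : Set Hgrp) (u : Hgrp → ℝ) : Set Hgrp :=
  {g ∈ Ω | XlimExists u g ∧ YlimExists u g}

/-- The level set `Σ^E_v = {g ∈ E ∩ D : 𝕏u(g) = v}`. -/
def SigmaSet (Ω : Set Hgrp) (u : Hgrp → ℝ) (E : Set Hgrp) (v : ℝ × ℝ) : Set Hgrp :=
  {g ∈ E ∩ Dset Ω u | XXgrad u g = v}

/-- The Monge–Ampère set function `ν_u(E) = ∫_{ℝ²} 𝓗²_ρ(Σ^E_v) dv`. -/
def nuMA (Ω : Set Hgrp) (u : Hgrp → ℝ) (E : Set Hgrp) : ℝ≥0∞ :=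
  ∫⁻ v : ℝ × ℝ, kHaus2 (SigmaSet Ω u E v)

/-- Convexity along all horizontal Euclidean segments with endpoints in `Ω`. -/
def ConvexOnHorizontalSegments (Ω : Set Hgrp) (u : Hgrp → ℝ) : Prop :=
  ∀ x y t x' y' t' : ℝ, (x, y, t) ∈ Ω → (x', y', t') ∈ Ω →
    t' = t + 2 * y * x' - 2 * x * y' → ∀ l : ℝ, 0 ≤ l → l ≤ 1 →
      u (x + l * (x' - x), y + l * (y' - y), t + l * (t' - t)) ≤
        u (x, y, t) + l * (u (x', y', t') - u (x, y, t))

theorem HConvexOn.convexOnHorizontalSegments {Ω : Set Hgrp} {u : Hgrp → ℝ}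
    (hu : HConvexOn Ω u) : ConvexOnHorizontalSegments Ω u := by
  intro x y t x' y' t' h h' ht l hl0 hl1
  have key := hu (x, y, t) h (x', y', t') ⟨ht, h'⟩ l ⟨hl0, hl1⟩
  have e : hmul (x, y, t) (hdil l (hmul (hinv (x, y, t)) (x', y', t'))) =
      (x + l * (x' - x), y + l * (y' - y), t + l * (t' - t)) := by
    subst ht
    simp only [hmul, hdil, hinv, Prod.mk.injEq]
    refine ⟨by ring, by ring, by ring⟩
  rwa [e] at key

theorem ConvexOnHorizontalSegments.comp_hmul_hdil {Ω : Set Hgrp} {u : Hgrp → ℝ}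
    (hu : ConvexOnHorizontalSegments Ω u) (g : Hgrp) (r : ℝ) :
    ConvexOnHorizontalSegments {h | hmul g (hdil r h) ∈ Ω}
      (fun h => u (hmul g (hdil r h))) := by
  obtain ⟨a, b, c⟩ := g
  intro x y t x' y' t' h h' ht l hl0 hl1
  have key := hu _ _ _ _ _ _ h h' (by subst ht; simp only [hdil]; ring) l hl0 hl1
  refine le_of_eq_of_le (congrArg u ?_) key
  simp only [hmul, hdil, Prod.mk.injEq]
  refine ⟨by ring, by ring, by ring⟩

theorem ConvexOnHorizontalSegments.le_of_le {Ω : Set Hgrp} {u : Hgrp → ℝ}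
    (hu : ConvexOnHorizontalSegments Ω u) {M x y t x' y' t' : ℝ}
    (h : (x, y, t) ∈ Ω) (h' : (x', y', t') ∈ Ω)
    (ht : t' = t + 2 * y * x' - 2 * x * y') (hM : u (x, y, t) ≤ M)
    (hM' : u (x', y', t') ≤ M) {l : ℝ} (hl0 : 0 ≤ l) (hl1 : l ≤ 1) :
    u (x + l * (x' - x), y + l * (y' - y), t + l * (t' - t)) ≤ M := by
  have := hu _ _ _ _ _ _ h h' ht l hl0 hl1
  nlinarith

/-- The horizontal convex hull of eight points contains a neighbourhood of the origin. -/
theorem ConvexOnHorizontalSegments.exists_upper_bound {Ω : Set Hgrp} {u : Hgrp → ℝ}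
    (hu : ConvexOnHorizontalSegments Ω u)
    (hΩ : ∀ x y t : ℝ, |x| ≤ 4 → |y| ≤ 4 → |t| ≤ 4 → (x, y, t) ∈ Ω) :
    ∃ M, ∀ x y t : ℝ, |x| ≤ 1 / 4 → |y| ≤ 1 / 4 → |t| ≤ 1 / 4 → u (x, y, t) ≤ M := by
  have mem : ∀ x y t : ℝ, -4 ≤ x → x ≤ 4 → -4 ≤ y → y ≤ 4 → -4 ≤ t → t ≤ 4 →
      (x, y, t) ∈ Ω := fun x y t h1 h2 h3 h4 h5 h6 =>
    hΩ x y t (abs_le.2 ⟨h1, h2⟩) (abs_le.2 ⟨h3, h4⟩) (abs_le.2 ⟨h5, h6⟩)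
  have ruled : ∀ a : ℝ, -1 ≤ a → a ≤ 1 → ∃ M, ∀ s θ : ℝ, |s| ≤ 1 → |θ| ≤ 1 →
      u (a + θ * s, θ, 2 * s - 2 * a * θ) ≤ M := by
    intro a ha ha'
    have seg : ∀ b : ℝ, -1 ≤ b → b ≤ 1 → ∃ M, ∀ s : ℝ, |s| ≤ 1 →
        u (a + s, b, 2 * b * s - 2 * a * b) ≤ M := by
      intro b hb hb'
      refine ⟨max (u (a - 1, b, -2 * b - 2 * a * b)) (u (a + 1, b, 2 * b - 2 * a * b)),
        fun s hs => ?_⟩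
      obtain ⟨h1, h2⟩ := abs_le.1 hs
      have := hu.le_of_le (mem (a - 1) b (-2 * b - 2 * a * b) (by linarith) (by linarith)
          (by linarith) (by linarith) (by nlinarith) (by nlinarith))
        (mem (a + 1) b (2 * b - 2 * a * b) (by linarith) (by linarith)
          (by linarith) (by linarith) (by nlinarith) (by nlinarith)) (by ring)
        (le_max_left _ _) (le_max_right _ _) (l := (s + 1) / 2) (by linarith) (by linarith)
      refine le_of_eq_of_le (congrArg u ?_) this
      simp only [Prod.mk.injEq]
      refine ⟨by ring, by ring, by ring⟩
    obtain ⟨M₁, hM₁⟩ := seg 1 (by norm_num) le_rfl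
    obtain ⟨M₂, hM₂⟩ := seg (-1) le_rfl (by norm_num)
    refine ⟨max M₁ M₂, fun s θ hs hθ => ?_⟩
    obtain ⟨h1, h2⟩ := abs_le.1 hs
    obtain ⟨h3, h4⟩ := abs_le.1 hθ
    have e₁ := hM₁ s hs
    have e₂ := hM₂ (-s) (by rwa [abs_neg])
    have := hu.le_of_le (mem _ _ _ (by linarith) (by linarith)
        (by linarith) (by linarith) (by linarith) (by linarith))
      (mem _ _ _ (by linarith) (by linarith)
        (by linarith) (by linarith) (by linarith) (by linarith)) (by ring)
      (e₂.trans (le_max_right M₁ M₂)) (e₁.trans (le_max_left M₁ M₂))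
      (l := (θ + 1) / 2) (by linarith) (by linarith)
    refine le_of_eq_of_le (congrArg u ?_) this
    simp only [Prod.mk.injEq]
    refine ⟨by ring, by ring, by ring⟩
  obtain ⟨M₁, hM₁⟩ := ruled 1 (by norm_num) le_rfl
  obtain ⟨M₂, hM₂⟩ := ruled (-1) le_rfl (by norm_num)
  refine ⟨max M₁ M₂, fun x y t hx hy ht => ?_⟩
  obtain ⟨x1, x2⟩ := abs_le.1 hx
  obtain ⟨y1, y2⟩ := abs_le.1 hy
  obtain ⟨t1, t2⟩ := abs_le.1 ht
  have hyy : y ^ 2 ≤ 1 / 16 := by nlinarith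
  have hyy0 := sq_nonneg y
  have hd : 0 < 1 - y ^ 2 := by linarith
  have hyt : |y * t| ≤ 1 / 16 := by
    rw [abs_mul]
    calc |y| * |t| ≤ 1 / 4 * (1 / 4) := by gcongr
      _ = 1 / 16 := by norm_num
  obtain ⟨yt1, yt2⟩ := abs_le.1 hyt
  obtain ⟨s₁, hs₁⟩ : ∃ s₁, s₁ = (1 - x + y * t / 2 + y ^ 2) / (1 - y ^ 2) := ⟨_, rfl⟩
  obtain ⟨s₂, hs₂⟩ : ∃ s₂, s₂ = (1 + x - y * t / 2 + y ^ 2) / (1 - y ^ 2) := ⟨_, rfl⟩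
  have hs₁0 : 0 < s₁ := by rw [hs₁]; exact div_pos (by linarith) hd
  have hs₂0 : 0 < s₂ := by rw [hs₂]; exact div_pos (by linarith) hd
  have hs₁2 : s₁ ≤ 2 := by rw [hs₁, div_le_iff₀ hd]; linarith
  have hs₂2 : s₂ ≤ 2 := by rw [hs₂, div_le_iff₀ hd]; linarith
  rw [eq_div_iff hd.ne'] at hs₁ hs₂
  have hys₁ : |y * s₁| ≤ 1 / 2 := by
    rw [abs_mul, abs_of_pos hs₁0]
    calc |y| * s₁ ≤ 1 / 4 * 2 := by gcongr
      _ = 1 / 2 := by norm_num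
  have hys₂ : |y * s₂| ≤ 1 / 2 := by
    rw [abs_mul, abs_of_pos hs₂0]
    calc |y| * s₂ ≤ 1 / 4 * 2 := by gcongr
      _ = 1 / 2 := by norm_num
  obtain ⟨a1, a2⟩ := abs_le.1 hys₁
  obtain ⟨b1, b2⟩ := abs_le.1 hys₂
  have e₁ := hM₁ ((t + 2 * y * s₁ + 2 * y) / 2) y
    (abs_le.2 ⟨by linarith, by linarith⟩) (by linarith)
  have e₂ := hM₂ ((t - 2 * y * s₂ - 2 * y) / 2) y
    (abs_le.2 ⟨by linarith, by linarith⟩) (by linarith)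
  have p₁ : ((1 : ℝ) + y * ((t + 2 * y * s₁ + 2 * y) / 2), y,
      2 * ((t + 2 * y * s₁ + 2 * y) / 2) - 2 * 1 * y) = (x + s₁, y, t + 2 * y * s₁) := by
    simp only [Prod.mk.injEq]
    refine ⟨by linarith, trivial, by ring⟩
  have p₂ : ((-1 : ℝ) + y * ((t - 2 * y * s₂ - 2 * y) / 2), y,
      2 * ((t - 2 * y * s₂ - 2 * y) / 2) - 2 * -1 * y) = (x - s₂, y, t - 2 * y * s₂) := by
    simp only [Prod.mk.injEq]
    refine ⟨by linarith, trivial, by ring⟩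
  rw [p₁] at e₁
  rw [p₂] at e₂
  have hsum : 0 < s₁ + s₂ := by linarith
  have := hu.le_of_le (mem _ _ _ (by linarith) (by linarith)
      (by linarith) (by linarith) (by linarith) (by linarith))
    (mem _ _ _ (by linarith) (by linarith)
      (by linarith) (by linarith) (by linarith) (by linarith)) (by ring)
    (e₂.trans (le_max_right M₁ M₂)) (e₁.trans (le_max_left M₁ M₂))
    (l := s₂ / (s₁ + s₂)) (by positivity) (by rw [div_le_one hsum]; linarith)
  refine le_of_eq_of_le (congrArg u ?_) this
  simp only [Prod.mk.injEq]
  refine ⟨by field_simp; ring, by ring, by field_simp; ring⟩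

/-- Harnack-type comparison of `M - u` at two nearby horizontally related points. -/
theorem ConvexOnHorizontalSegments.harnack {Ω : Set Hgrp} {u : Hgrp → ℝ}
    (hu : ConvexOnHorizontalSegments Ω u)
    (hΩ : ∀ x y t : ℝ, |x| ≤ 4 → |y| ≤ 4 → |t| ≤ 4 → (x, y, t) ∈ Ω) {M : ℝ}
    (hM : ∀ x y t : ℝ, |x| ≤ 1 / 4 → |y| ≤ 1 / 4 → |t| ≤ 1 / 4 → u (x, y, t) ≤ M)
    {l x y t x' y' t' : ℝ} (hl0 : 0 < l) (hl1 : l ≤ 1)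
    (hx : |x| ≤ 1 / 8) (hy : |y| ≤ 1 / 8) (ht : |t| ≤ 1 / 8)
    (hdx : |x' - x| ≤ l / 8) (hdy : |y' - y| ≤ l / 8) (hdt : |t' - t| ≤ l / 8)
    (hor : t' = t + 2 * y * x' - 2 * x * y') :
    (1 - l) * (M - u (x, y, t)) ≤ M - u (x', y', t') := by
  have aux : ∀ a a' : ℝ, |a| ≤ 1 / 8 → |a' - a| ≤ l / 8 → |a + (a' - a) / l| ≤ 1 / 4 := by
    intro a a' h h'
    have : |(a' - a) / l| ≤ 1 / 8 := by
      rw [abs_div, abs_of_pos hl0, div_le_iff₀ hl0]; linarith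
    linarith [abs_add_le a ((a' - a) / l)]
  have bx := aux x x' hx hdx
  have bY := aux y y' hy hdy
  have bt := aux t t' ht hdt
  have b := hM _ _ _ bx bY bt
  have key := hu x y t _ _ _ (hΩ _ _ _ (by linarith) (by linarith) (by linarith))
    (hΩ _ _ _ (bx.trans (by norm_num)) (bY.trans (by norm_num)) (bt.trans (by norm_num)))
    (by subst hor; field_simp; ring) l hl0.le hl1
  have e : (x + l * (x + (x' - x) / l - x), y + l * (y + (y' - y) / l - y),
      t + l * (t + (t' - t) / l - t)) = (x', y', t') := by
    simp only [Prod.mk.injEq]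
    refine ⟨by field_simp; ring, by field_simp; ring, by field_simp; ring⟩
  rw [e] at key
  nlinarith

set_option maxHeartbeats 1000000 in
/-- Comparison of `M - u` at the origin and at a nearby point, obtained by joining them through
three short horizontal segments. -/
theorem ConvexOnHorizontalSegments.harnack_zero {Ω : Set Hgrp} {u : Hgrp → ℝ}
    (hu : ConvexOnHorizontalSegments Ω u)
    (hΩ : ∀ x y t : ℝ, |x| ≤ 4 → |y| ≤ 4 → |t| ≤ 4 → (x, y, t) ∈ Ω) {M : ℝ}
    (hM : ∀ x y t : ℝ, |x| ≤ 1 / 4 → |y| ≤ 1 / 4 → |t| ≤ 1 / 4 → u (x, y, t) ≤ M)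
    {l x y t : ℝ} (hl0 : 0 < l) (hl1 : l ≤ 1) (hx : |x| ≤ l ^ 2 / 4096)
    (hy : |y| ≤ l ^ 2 / 4096) (ht : |t| ≤ l ^ 2 / 4096) :
    (1 - l) ^ 3 * (M - u (0, 0, 0)) ≤ M - u (x, y, t) ∧
      (1 - l) ^ 3 * (M - u (x, y, t)) ≤ M - u (0, 0, 0) := by
  have hll : l ^ 2 ≤ l := by nlinarith
  have hl' : 0 ≤ 1 - l := by linarith
  obtain ⟨r, hr⟩ : ∃ r, r = l / 32 := ⟨_, rfl⟩
  have hr0 : 0 < r := by rw [hr]; positivity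
  have hry : |r * y| ≤ l ^ 2 / 4096 := by
    rw [abs_mul, abs_of_pos hr0]
    nlinarith [abs_nonneg y]
  obtain ⟨x1, x2⟩ := abs_le.1 hx
  obtain ⟨y1, y2⟩ := abs_le.1 hy
  obtain ⟨t1, t2⟩ := abs_le.1 ht
  obtain ⟨r1, r2⟩ := abs_le.1 hry
  have hxr : 0 < x + r := by linarith
  obtain ⟨b, hb⟩ : ∃ b, b = (t + 2 * (r * y)) / (2 * (x + r)) := ⟨_, rfl⟩
  have hb' : |b| ≤ l / 32 := by
    rw [hb, abs_div, abs_of_pos (show 0 < 2 * (x + r) by linarith),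
      div_le_iff₀ (by linarith)]
    refine abs_le.2 ⟨?_, ?_⟩ <;> nlinarith
  rw [eq_div_iff (by linarith)] at hb
  obtain ⟨b1, b2⟩ := abs_le.1 hb'
  have H := @ConvexOnHorizontalSegments.harnack Ω u hu hΩ M hM l
  have s₁ := @H 0 0 0 0 b 0 hl0 hl1 (abs_le.2 ⟨by linarith, by linarith⟩)
    (abs_le.2 ⟨by linarith, by linarith⟩) (abs_le.2 ⟨by linarith, by linarith⟩)
    (abs_le.2 ⟨by linarith, by linarith⟩) (abs_le.2 ⟨by linarith, by linarith⟩)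
    (abs_le.2 ⟨by linarith, by linarith⟩) (by ring)
  have s₁' := @H 0 b 0 0 0 0 hl0 hl1 (abs_le.2 ⟨by linarith, by linarith⟩)
    (abs_le.2 ⟨by linarith, by linarith⟩) (abs_le.2 ⟨by linarith, by linarith⟩)
    (abs_le.2 ⟨by linarith, by linarith⟩) (abs_le.2 ⟨by linarith, by linarith⟩)
    (abs_le.2 ⟨by linarith, by linarith⟩) (by ring)
  have s₂ := @H 0 b 0 (x + r) y (t + 2 * (r * y)) hl0 hl1
    (abs_le.2 ⟨by linarith, by linarith⟩)
    (abs_le.2 ⟨by linarith, by linarith⟩) (abs_le.2 ⟨by linarith, by linarith⟩)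
    (abs_le.2 ⟨by linarith, by linarith⟩) (abs_le.2 ⟨by linarith, by linarith⟩)
    (abs_le.2 ⟨by linarith, by linarith⟩) (by linarith)
  have s₂' := @H (x + r) y (t + 2 * (r * y)) 0 b 0 hl0 hl1
    (abs_le.2 ⟨by linarith, by linarith⟩)
    (abs_le.2 ⟨by linarith, by linarith⟩) (abs_le.2 ⟨by linarith, by linarith⟩)
    (abs_le.2 ⟨by linarith, by linarith⟩) (abs_le.2 ⟨by linarith, by linarith⟩)
    (abs_le.2 ⟨by linarith, by linarith⟩) (by linarith)
  have s₃ := @H (x + r) y (t + 2 * (r * y)) x y t hl0 hl1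
    (abs_le.2 ⟨by linarith, by linarith⟩)
    (abs_le.2 ⟨by linarith, by linarith⟩) (abs_le.2 ⟨by linarith, by linarith⟩)
    (abs_le.2 ⟨by linarith, by linarith⟩) (abs_le.2 ⟨by linarith, by linarith⟩)
    (abs_le.2 ⟨by linarith, by linarith⟩) (by ring)
  have s₃' := @H x y t (x + r) y (t + 2 * (r * y)) hl0 hl1
    (abs_le.2 ⟨by linarith, by linarith⟩)
    (abs_le.2 ⟨by linarith, by linarith⟩) (abs_le.2 ⟨by linarith, by linarith⟩)
    (abs_le.2 ⟨by linarith, by linarith⟩) (abs_le.2 ⟨by linarith, by linarith⟩)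
    (abs_le.2 ⟨by linarith, by linarith⟩) (by ring)
  constructor
  · calc (1 - l) ^ 3 * (M - u (0, 0, 0))
        = (1 - l) * ((1 - l) * ((1 - l) * (M - u (0, 0, 0)))) := by ring
      _ ≤ (1 - l) * ((1 - l) * (M - u (0, b, 0))) := by gcongr
      _ ≤ (1 - l) * (M - u (x + r, y, t + 2 * (r * y))) := by gcongr
      _ ≤ _ := s₃
  · calc (1 - l) ^ 3 * (M - u (x, y, t))
        = (1 - l) * ((1 - l) * ((1 - l) * (M - u (x, y, t)))) := by ring
      _ ≤ (1 - l) * ((1 - l) * (M - u (x + r, y, t + 2 * (r * y)))) := by gcongr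
      _ ≤ (1 - l) * (M - u (0, b, 0)) := by gcongr
      _ ≤ _ := s₁'

theorem ConvexOnHorizontalSegments.continuousAt_zero {Ω : Set Hgrp} {u : Hgrp → ℝ}
    (hu : ConvexOnHorizontalSegments Ω u)
    (hΩ : ∀ x y t : ℝ, |x| ≤ 4 → |y| ≤ 4 → |t| ≤ 4 → (x, y, t) ∈ Ω) :
    ContinuousAt u (0, 0, 0) := by
  obtain ⟨M, hM⟩ := hu.exists_upper_bound hΩ
  rw [Metric.continuousAt_iff]
  intro ε hε
  obtain ⟨W, hW⟩ : ∃ W, W = M - u (0, 0, 0) := ⟨_, rfl⟩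
  have lim₁ : Tendsto (fun l : ℝ => (1 - l) ^ 3 * W) (𝓝[>] 0) (𝓝 W) := by
    have : ContinuousAt (fun l : ℝ => (1 - l) ^ 3 * W) 0 := by fun_prop
    simpa [ContinuousAt] using this.tendsto.mono_left nhdsWithin_le_nhds
  have lim₂ : Tendsto (fun l : ℝ => (1 - l) ^ 3 * (W + ε)) (𝓝[>] 0) (𝓝 (W + ε)) := by
    have : ContinuousAt (fun l : ℝ => (1 - l) ^ 3 * (W + ε)) 0 := by fun_prop
    simpa [ContinuousAt] using this.tendsto.mono_left nhdsWithin_le_nhds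
  obtain ⟨l, h₁, h₂, hl0, hl1⟩ := ((lim₁.eventually (lt_mem_nhds (sub_lt_self W hε))).and
    ((lim₂.eventually (lt_mem_nhds (lt_add_of_pos_right W hε))).and
      (Ioo_mem_nhdsGT (show (0 : ℝ) < 1 by norm_num)))).exists
  refine ⟨l ^ 2 / 4096, by positivity, ?_⟩
  rintro ⟨x, y, t⟩ hd
  simp only [Prod.dist_eq, Real.dist_eq, sub_zero, max_lt_iff] at hd
  obtain ⟨k₁, k₂⟩ := hu.harnack_zero hΩ hM hl0 hl1.le hd.1.le hd.2.1.le hd.2.2.le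
  rw [← hW] at k₁ k₂
  have hpos : 0 < (1 - l) ^ 3 := pow_pos (by linarith) 3
  have k₃ : M - u (x, y, t) < W + ε :=
    lt_of_mul_lt_mul_left (k₂.trans_lt h₂) hpos.le
  rw [Real.dist_eq, abs_lt]
  constructor <;> linarith

theorem hmul_hinv_cancel_left (g h : Hgrp) : hmul g (hmul (hinv g) h) = h := by
  obtain ⟨a, b, c⟩ := g
  obtain ⟨x, y, t⟩ := h
  simp only [hmul, hinv, Prod.mk.injEq]
  refine ⟨by ring, by ring, by ring⟩

theorem ConvexOnHorizontalSegments.continuousAt {Ω : Set Hgrp} {u : Hgrp → ℝ}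
    (hu : ConvexOnHorizontalSegments Ω u) (hΩ : IsOpen Ω) {g : Hgrp} (hg : g ∈ Ω) :
    ContinuousAt u g := by
  obtain ⟨ρ, hρ, hball⟩ : ∃ ρ > 0, ∀ x y t : ℝ, |x| < ρ → |y| < ρ → |t| < ρ →
      hmul g (x, y, t) ∈ Ω := by
    have hc : Continuous (fun h : Hgrp => hmul g h) := by
      unfold hmul; fun_prop
    have ho : IsOpen {h : Hgrp | hmul g h ∈ Ω} := hΩ.preimage hc
    obtain ⟨ρ, hρ, hb⟩ := Metric.isOpen_iff.1 ho (0, 0, 0) (by simpa [hmul] using hg)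
    refine ⟨ρ, hρ, fun x y t hx hy ht => hb ?_⟩
    simp [Prod.dist_eq, hx, hy, ht]
  obtain ⟨r, hr0, hr1, hrρ⟩ : ∃ r : ℝ, 0 < r ∧ r ≤ 1 ∧ 4 * r < ρ :=
    ⟨min 1 (ρ / 8), by positivity, min_le_left _ _, by
      linarith [min_le_right 1 (ρ / 8)]⟩
  have hcont := (hu.comp_hmul_hdil g r).continuousAt_zero (by
    intro x y t hx hy ht
    refine hball _ _ _ ?_ ?_ ?_
    · rw [abs_mul, abs_of_pos hr0]; nlinarith
    · rw [abs_mul, abs_of_pos hr0]; nlinarith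
    · rw [abs_mul, abs_of_pos (by positivity)]; nlinarith [abs_nonneg t])
  have hinner : Continuous (fun h : Hgrp => hdil r⁻¹ (hmul (hinv g) h)) := by
    unfold hdil hmul hinv; fun_prop
  have h0 : hdil r⁻¹ (hmul (hinv g) g) = (0, 0, 0) := by
    simp only [hdil, hmul, hinv, Prod.mk.injEq]
    refine ⟨by ring, by ring, by ring⟩
  have hcomp := ContinuousAt.comp_of_eq hcont hinner.continuousAt h0
  convert hcomp using 1
  funext h
  have hd : ∀ k : Hgrp, hdil r (hdil r⁻¹ k) = k := by
    rintro ⟨x, y, t⟩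
    simp only [hdil, Prod.mk.injEq]
    refine ⟨by field_simp, by field_simp, by field_simp⟩
  simp only [Function.comp, hd, hmul_hinv_cancel_left]

/-- If `u` is touched from above at `(x₀, y₀, t₀)` by a paraboloid, then its H-subdifferential
there is nonempty. -/
theorem ConvexOnHorizontalSegments.hsub_nonempty_of_touching {Ω : Set Hgrp} {u : Hgrp → ℝ}
    (hu : ConvexOnHorizontalSegments Ω u) (hΩ : IsOpen Ω) {x₀ y₀ t₀ x₁ y₁ t₁ K : ℝ}
    (hg : (x₀, y₀, t₀) ∈ Ω)
    (htouch : ∀ᶠ h : Hgrp in 𝓝 (x₀, y₀, t₀),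
      K * ((x₀ - x₁) ^ 2 + (y₀ - y₁) ^ 2 + (t₀ - t₁) ^ 2) - u (x₀, y₀, t₀) ≤
        K * ((h.1 - x₁) ^ 2 + (h.2.1 - y₁) ^ 2 + (h.2.2 - t₁) ^ 2) - u h) :
    (hsub Ω u (x₀, y₀, t₀)).Nonempty := by
  refine ⟨(2 * K * (x₀ - x₁ + 2 * y₀ * (t₀ - t₁)), 2 * K * (y₀ - y₁ - 2 * x₀ * (t₀ - t₁))), ?_⟩
  rintro ⟨x, y, t⟩ ⟨hpl, hm⟩
  have ht : t = t₀ + 2 * y₀ * x - 2 * x₀ * y := hpl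
  have hc : Continuous (fun s : ℝ => ((x₀ - s * (x - x₀), y₀ - s * (y - y₀),
      t₀ - s * (t - t₀)) : Hgrp)) := by fun_prop
  have hlim : Tendsto (fun s : ℝ => ((x₀ - s * (x - x₀), y₀ - s * (y - y₀),
      t₀ - s * (t - t₀)) : Hgrp)) (𝓝[>] 0) (𝓝 (x₀, y₀, t₀)) := by
    have := (hc.tendsto 0).mono_left (nhdsWithin_le_nhds (s := Ioi 0))
    simpa using this
  have hlow : Tendsto (fun s : ℝ => u (x₀, y₀, t₀) +
      2 * K * ((x₀ - x₁) * (x - x₀) + (y₀ - y₁) * (y - y₀) + (t₀ - t₁) * (t - t₀)) -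
      K * s * ((x - x₀) ^ 2 + (y - y₀) ^ 2 + (t - t₀) ^ 2)) (𝓝[>] 0)
      (𝓝 (u (x₀, y₀, t₀) +
      2 * K * ((x₀ - x₁) * (x - x₀) + (y₀ - y₁) * (y - y₀) + (t₀ - t₁) * (t - t₀)))) := by
    have : Continuous (fun s : ℝ => u (x₀, y₀, t₀) +
      2 * K * ((x₀ - x₁) * (x - x₀) + (y₀ - y₁) * (y - y₀) + (t₀ - t₁) * (t - t₀)) -
      K * s * ((x - x₀) ^ 2 + (y - y₀) ^ 2 + (t - t₀) ^ 2)) := by fun_prop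
    simpa using (this.tendsto 0).mono_left (nhdsWithin_le_nhds (s := Ioi 0))
  have key : u (x₀, y₀, t₀) +
      2 * K * ((x₀ - x₁) * (x - x₀) + (y₀ - y₁) * (y - y₀) + (t₀ - t₁) * (t - t₀)) ≤
      u (x, y, t) := by
    refine le_of_tendsto hlow ?_
    filter_upwards [hlim.eventually htouch, hlim.eventually (hΩ.mem_nhds hg),
      self_mem_nhdsWithin] with s h₁ h₂ h₃
    have hs : 0 < s := h₃
    have hs1 : 0 < 1 + s := by linarith
    have h₄ := hu _ _ _ _ _ _ h₂ hm (by rw [ht]; ring) (s / (1 + s)) (by positivity)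
      (by rw [div_le_one hs1]; linarith)
    have e : ((x₀ - s * (x - x₀) + s / (1 + s) * (x - (x₀ - s * (x - x₀))),
        y₀ - s * (y - y₀) + s / (1 + s) * (y - (y₀ - s * (y - y₀))),
        t₀ - s * (t - t₀) + s / (1 + s) * (t - (t₀ - s * (t - t₀)))) : Hgrp) =
        (x₀, y₀, t₀) := by
      simp only [Prod.mk.injEq]
      refine ⟨by field_simp; ring, by field_simp; ring, by field_simp; ring⟩
    rw [e] at h₄
    have h₅ := mul_le_mul_of_nonneg_left h₄ hs1.le
    rw [mul_add, ← mul_assoc, mul_div_cancel₀ _ hs1.ne'] at h₅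
    refine le_of_mul_le_mul_left ?_ hs
    linarith
  have e : dot (2 * K * (x₀ - x₁ + 2 * y₀ * (t₀ - t₁)), 2 * K * (y₀ - y₁ - 2 * x₀ * (t₀ - t₁)))
      (xi1 (x, y, t) - xi1 (x₀, y₀, t₀)) =
      2 * K * ((x₀ - x₁) * (x - x₀) + (y₀ - y₁) * (y - y₀) + (t₀ - t₁) * (t - t₀)) := by
    simp only [dot, xi1, Prod.mk_sub_mk, ht]
    ring
  rw [e]
  exact key

theorem ConvexOnHorizontalSegments.frequently_hsub_nonempty {Ω : Set Hgrp} {u : Hgrp → ℝ}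
    (hu : ConvexOnHorizontalSegments Ω u) (hΩ : IsOpen Ω) {g : Hgrp} (hg : g ∈ Ω) :
    ∃ᶠ h in 𝓝 g, h ∈ Ω ∧ (hsub Ω u h).Nonempty := by
  rw [Filter.frequently_iff]
  intro U hU
  obtain ⟨r, hr, hb⟩ := Metric.nhds_basis_closedBall.mem_iff.1
    (Filter.inter_mem hU (hΩ.mem_nhds hg))
  obtain ⟨x₁, y₁, t₁⟩ := g
  have hcu : ContinuousOn u (Metric.closedBall (x₁, y₁, t₁) r) := fun h hh =>
    (hu.continuousAt hΩ (hb hh).2).continuousWithinAt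
  have hcomp := isCompact_closedBall ((x₁, y₁, t₁) : Hgrp) r
  have hne : (Metric.closedBall ((x₁, y₁, t₁) : Hgrp) r).Nonempty :=
    ⟨_, Metric.mem_closedBall_self hr.le⟩
  obtain ⟨m, -, hmax⟩ := hcomp.exists_isMaxOn hne hcu
  obtain ⟨K, hK⟩ : ∃ K, K = (u m - u (x₁, y₁, t₁) + 1) / r ^ 2 := ⟨_, rfl⟩
  have hm0 : u (x₁, y₁, t₁) ≤ u m := hmax (Metric.mem_closedBall_self hr.le)
  have hK0 : 0 < K := by rw [hK]; exact div_pos (by linarith) (by positivity)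
  rw [eq_div_iff (by positivity)] at hK
  obtain ⟨⟨x₀, y₀, t₀⟩, h0, hmin⟩ := hcomp.exists_isMinOn hne
    (f := fun h : Hgrp => K * ((h.1 - x₁) ^ 2 + (h.2.1 - y₁) ^ 2 + (h.2.2 - t₁) ^ 2) - u h)
    (ContinuousOn.sub (by fun_prop) hcu)
  refine ⟨_, (hb h0).1, (hb h0).2, hu.hsub_nonempty_of_touching hΩ (x₁ := x₁) (y₁ := y₁)
    (t₁ := t₁) (K := K) (hb h0).2 ?_⟩
  have hint : ((x₀, y₀, t₀) : Hgrp) ∈ Metric.ball ((x₁, y₁, t₁) : Hgrp) r := by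
    have hle : u (x₀, y₀, t₀) ≤ u m := hmax h0
    have hc : K * ((x₀ - x₁) ^ 2 + (y₀ - y₁) ^ 2 + (t₀ - t₁) ^ 2) - u (x₀, y₀, t₀) ≤
        K * ((x₁ - x₁) ^ 2 + (y₁ - y₁) ^ 2 + (t₁ - t₁) ^ 2) - u (x₁, y₁, t₁) :=
      hmin (Metric.mem_closedBall_self hr.le)
    have hlt : (x₀ - x₁) ^ 2 + (y₀ - y₁) ^ 2 + (t₀ - t₁) ^ 2 < r ^ 2 := by
      refine lt_of_mul_lt_mul_left ?_ hK0.le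
      simp only [sub_self] at hc
      linarith
    simp only [Metric.mem_ball, Prod.dist_eq, Real.dist_eq, max_lt_iff]
    refine ⟨abs_lt_of_sq_lt_sq ?_ hr.le, abs_lt_of_sq_lt_sq ?_ hr.le,
      abs_lt_of_sq_lt_sq ?_ hr.le⟩ <;>
    linarith [sq_nonneg (x₀ - x₁), sq_nonneg (y₀ - y₁), sq_nonneg (t₀ - t₁)]
  filter_upwards [Metric.isOpen_ball.mem_nhds hint] with h hh
  exact hmin (Metric.ball_subset_closedBall hh)

theorem ConvexOnHorizontalSegments.eventually_dot_le {Ω : Set Hgrp} {u : Hgrp → ℝ}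
    (hu : ConvexOnHorizontalSegments Ω u) (hΩ : IsOpen Ω) {g : Hgrp} (hg : g ∈ Ω)
    (w : ℝ × ℝ) : ∃ C, ∀ᶠ h in 𝓝 g, ∀ p ∈ hsub Ω u h, dot p w ≤ C := by
  have hc : Continuous (fun r : ℝ => hmul g (hexp (r * w.1, r * w.2))) := by
    unfold hmul hexp; fun_prop
  have hlim : Tendsto (fun r : ℝ => hmul g (hexp (r * w.1, r * w.2))) (𝓝[>] 0) (𝓝 g) := by
    simpa [hmul, hexp] using (hc.tendsto 0).mono_left (nhdsWithin_le_nhds (s := Ioi 0))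
  obtain ⟨r, hr, hr0⟩ := ((hlim.eventually (hΩ.mem_nhds hg)).and self_mem_nhdsWithin).exists
  have hr0 : 0 < r := hr0
  have hc' : Continuous (fun h : Hgrp => hmul h (hexp (r * w.1, r * w.2))) := by
    unfold hmul hexp; fun_prop
  have hF : ContinuousAt (fun h : Hgrp => (u (hmul h (hexp (r * w.1, r * w.2))) - u h) / r) g :=
    ((ContinuousAt.comp_of_eq (hu.continuousAt hΩ hr) hc'.continuousAt rfl).sub
      (hu.continuousAt hΩ hg)).div_const r
  refine ⟨(u (hmul g (hexp (r * w.1, r * w.2))) - u g) / r + 1, ?_⟩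
  filter_upwards [hF.eventually (gt_mem_nhds (lt_add_one _)),
    hc'.continuousAt.eventually (hΩ.mem_nhds hr)] with h h₁ h₂ p hp
  refine le_trans ?_ h₁.le
  have := hp _ ⟨by simp only [hplane, hmul, hexp, mem_ofPred_eq]; ring, h₂⟩
  rw [le_div_iff₀ hr0]
  simp only [dot, xi1, hmul, hexp, Prod.mk_sub_mk, add_sub_cancel_left] at this ⊢
  linarith

theorem ConvexOnHorizontalSegments.mem_hsub_of_tendsto {Ω : Set Hgrp} {u : Hgrp → ℝ}
    (hu : ConvexOnHorizontalSegments Ω u) (hΩ : IsOpen Ω) {g : Hgrp} (hg : g ∈ Ω)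
    {G : ℕ → Hgrp} {P : ℕ → ℝ × ℝ} {p : ℝ × ℝ} (hG : Tendsto G atTop (𝓝 g))
    (hP : Tendsto P atTop (𝓝 p)) (h : ∀ᶠ n in atTop, P n ∈ hsub Ω u (G n)) :
    p ∈ hsub Ω u g := by
  rintro ⟨x, y, t⟩ ⟨hpl, hm⟩
  have ht : t = g.2.2 + 2 * g.2.1 * x - 2 * g.1 * y := hpl
  have hc : Continuous (fun k : Hgrp => ((x, y, k.2.2 + 2 * k.2.1 * x - 2 * k.1 * y) : Hgrp)) := by
    fun_prop
  have hlim : Tendsto (fun n => ((x, y, (G n).2.2 + 2 * (G n).2.1 * x - 2 * (G n).1 * y) : Hgrp))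
      atTop (𝓝 (x, y, t)) := by
    rw [ht]; exact (hc.tendsto g).comp hG
  have hd : Continuous (fun q : (ℝ × ℝ) × Hgrp => dot q.1 (xi1 (x, y, t) - xi1 q.2)) := by
    unfold dot xi1; fun_prop
  refine le_of_tendsto_of_tendsto
    (((hu.continuousAt hΩ hg).tendsto.comp hG).add
      ((hd.tendsto (p, g)).comp (hP.prodMk_nhds hG)))
    ((hu.continuousAt hΩ hm).tendsto.comp hlim) ?_
  filter_upwards [h, hlim.eventually (hΩ.mem_nhds hm)] with n h₁ h₂
  exact h₁ _ ⟨rfl, h₂⟩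

theorem ConvexOnHorizontalSegments.exists_subseq_hsub {Ω : Set Hgrp} {u : Hgrp → ℝ}
    (hu : ConvexOnHorizontalSegments Ω u) (hΩ : IsOpen Ω) {g : Hgrp} (hg : g ∈ Ω)
    {G : ℕ → Hgrp} {P : ℕ → ℝ × ℝ} (hG : Tendsto G atTop (𝓝 g))
    (h : ∀ᶠ n in atTop, P n ∈ hsub Ω u (G n)) :
    ∃ p ∈ hsub Ω u g, ∃ φ : ℕ → ℕ, StrictMono φ ∧ Tendsto (P ∘ φ) atTop (𝓝 p) := by
  obtain ⟨C₁, h₁⟩ := hu.eventually_dot_le hΩ hg (1, 0)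
  obtain ⟨C₂, h₂⟩ := hu.eventually_dot_le hΩ hg (-1, 0)
  obtain ⟨C₃, h₃⟩ := hu.eventually_dot_le hΩ hg (0, 1)
  obtain ⟨C₄, h₄⟩ := hu.eventually_dot_le hΩ hg (0, -1)
  have hcpt : IsCompact (Icc (-C₂) C₁ ×ˢ Icc (-C₄) C₃) := isCompact_Icc.prod isCompact_Icc
  have hmem : ∀ᶠ n in atTop, P n ∈ Icc (-C₂) C₁ ×ˢ Icc (-C₄) C₃ := by
    filter_upwards [h, hG.eventually h₁, hG.eventually h₂, hG.eventually h₃,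
      hG.eventually h₄] with n h k₁ k₂ k₃ k₄
    have k₁ := k₁ _ h
    have k₂ := k₂ _ h
    have k₃ := k₃ _ h
    have k₄ := k₄ _ h
    simp only [dot] at k₁ k₂ k₃ k₄
    exact ⟨⟨by linarith, by linarith⟩, ⟨by linarith, by linarith⟩⟩
  obtain ⟨p, -, φ, hφ, hlim⟩ := hcpt.tendsto_subseq' hmem.frequently
  exact ⟨p, hu.mem_hsub_of_tendsto hΩ hg (hG.comp hφ.tendsto_atTop) hlim
    (hφ.tendsto_atTop.eventually h), φ, hφ, hlim⟩

theorem ConvexOnHorizontalSegments.hsub_nonempty {Ω : Set Hgrp} {u : Hgrp → ℝ}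
    (hu : ConvexOnHorizontalSegments Ω u) (hΩ : IsOpen Ω) {g : Hgrp} (hg : g ∈ Ω) :
    (hsub Ω u g).Nonempty := by
  obtain ⟨G, hG, hmem⟩ :=
    Filter.exists_seq_forall_of_frequently (hu.frequently_hsub_nonempty hΩ hg)
  choose P hP using fun n => (hmem n).2
  obtain ⟨p, hp, -⟩ := hu.exists_subseq_hsub hΩ hg hG (Eventually.of_forall hP)
  exact ⟨p, hp⟩

/-- A subgradient bounds from below the increments of `u` in a horizontal direction. -/
theorem mul_dot_le_of_mem_hsub {Ω : Set Hgrp} {u : Hgrp → ℝ} {g : Hgrp} {p : ℝ × ℝ}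
    (hp : p ∈ hsub Ω u g) (w : ℝ × ℝ) {l : ℝ} (hl : hmul g (hexp (l • w)) ∈ Ω) :
    l * dot p w ≤ u (hmul g (hexp (l • w))) - u g := by
  have := hp _ ⟨by simp only [hplane, hmul, hexp, mem_ofPred_eq]; ring, hl⟩
  simp only [dot, xi1, hmul, hexp, Prod.mk_sub_mk, add_sub_cancel_left, Prod.smul_fst,
    Prod.smul_snd, smul_eq_mul] at this ⊢
  linarith

theorem sub_le_mul_dot_of_mem_hsub {Ω : Set Hgrp} {u : Hgrp → ℝ} {g : Hgrp} (hg : g ∈ Ω)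
    {p w : ℝ × ℝ} {l : ℝ} (hp : p ∈ hsub Ω u (hmul g (hexp (l • w)))) :
    u (hmul g (hexp (l • w))) - u g ≤ l * dot p w := by
  have := hp g ⟨by simp only [hplane, hmul, hexp, mem_ofPred_eq]; ring, hg⟩
  simp only [dot, xi1, hmul, hexp, Prod.mk_sub_mk, sub_add_cancel_left, Prod.smul_fst,
    Prod.smul_snd, smul_eq_mul] at this ⊢
  linarith

theorem tendsto_hmul_hexp_smul (g : Hgrp) (w : ℝ × ℝ) :
    Tendsto (fun l : ℝ => hmul g (hexp (l • w))) (𝓝 0) (𝓝 g) := by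
  have hc : Continuous (fun l : ℝ => hmul g (hexp (l • w))) := by
    unfold hmul hexp; fun_prop
  simpa [hmul, hexp] using hc.tendsto 0

theorem dot_eq_of_mem_hsub_of_tendsto {Ω : Set Hgrp} (hΩ : IsOpen Ω) {u : Hgrp → ℝ} {g : Hgrp}
    (hg : g ∈ Ω) {p w : ℝ × ℝ} (hp : p ∈ hsub Ω u g) {a : ℝ}
    (ha : Tendsto (fun l : ℝ => (u (hmul g (hexp (l • w))) - u g) / l) (𝓝[≠] 0) (𝓝 a)) :
    dot p w = a := by
  have hm := (tendsto_hmul_hexp_smul g w).eventually (hΩ.mem_nhds hg)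
  apply le_antisymm
  · refine ge_of_tendsto (ha.mono_left (nhdsGT_le_nhdsNE 0)) ?_
    filter_upwards [hm.filter_mono nhdsWithin_le_nhds, self_mem_nhdsWithin] with l h₁ h₂
    rw [le_div_iff₀ h₂, mul_comm]
    exact mul_dot_le_of_mem_hsub hp w h₁
  · refine le_of_tendsto (ha.mono_left (nhdsLT_le_nhdsNE 0)) ?_
    filter_upwards [hm.filter_mono nhdsWithin_le_nhds, self_mem_nhdsWithin] with l h₁ h₂
    rw [div_le_iff_of_neg h₂, mul_comm]
    exact mul_dot_le_of_mem_hsub hp w h₁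

/-- If the H-subdifferential is a singleton, then all horizontal derivatives exist. -/
theorem ConvexOnHorizontalSegments.tendsto_of_hsub_eq_singleton {Ω : Set Hgrp} {u : Hgrp → ℝ}
    (hu : ConvexOnHorizontalSegments Ω u) (hΩ : IsOpen Ω) {g : Hgrp} (hg : g ∈ Ω)
    {p : ℝ × ℝ} (hp : hsub Ω u g = {p}) (w : ℝ × ℝ) :
    Tendsto (fun l : ℝ => (u (hmul g (hexp (l • w))) - u g) / l) (𝓝[≠] 0) (𝓝 (dot p w)) := by
  have hm := (tendsto_hmul_hexp_smul g w).eventually (hΩ.mem_nhds hg)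
  have hpm : p ∈ hsub Ω u g := hp ▸ mem_singleton p
  refine tendsto_of_subseq_tendsto fun L hL => ?_
  have hL0 : Tendsto L atTop (𝓝 0) := hL.mono_right nhdsWithin_le_nhds
  have hLne : ∀ᶠ n in atTop, L n ≠ 0 := hL.eventually self_mem_nhdsWithin
  have hP : ∀ n, ∃ q, hmul g (hexp (L n • w)) ∈ Ω → q ∈ hsub Ω u (hmul g (hexp (L n • w))) := by
    intro n
    by_cases h : hmul g (hexp (L n • w)) ∈ Ω
    · obtain ⟨q, hq⟩ := hu.hsub_nonempty hΩ h
      exact ⟨q, fun _ => hq⟩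
    · exact ⟨0, fun h' => absurd h' h⟩
  choose P hP using hP
  have hLm := hL0.eventually hm
  have hPm : ∀ᶠ n in atTop, P n ∈ hsub Ω u (hmul g (hexp (L n • w))) := hLm.mono hP
  obtain ⟨q, hq, φ, hφ, hlim⟩ :=
    hu.exists_subseq_hsub hΩ hg ((tendsto_hmul_hexp_smul g w).comp hL0) hPm
  obtain rfl : q = p := by rw [hp] at hq; exact hq
  refine ⟨φ, ?_⟩
  have hd : Continuous (fun q : ℝ × ℝ => dot q w) := by unfold dot; fun_prop
  have hlim' : Tendsto (fun n => dot (P (φ n)) w) atTop (𝓝 (dot q w)) := (hd.tendsto q).comp hlim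
  have hmin := (tendsto_const_nhds (x := dot q w)).min hlim'
  have hmax := (tendsto_const_nhds (x := dot q w)).max hlim'
  rw [min_self] at hmin
  rw [max_self] at hmax
  have hall : ∀ᶠ n in atTop, L n ≠ 0 ∧ hmul g (hexp (L n • w)) ∈ Ω ∧
      P n ∈ hsub Ω u (hmul g (hexp (L n • w))) := hLne.and (hLm.and hPm)
  have hbd : ∀ᶠ n in atTop, min (dot q w) (dot (P (φ n)) w) ≤
      (u (hmul g (hexp (L (φ n) • w))) - u g) / L (φ n) ∧
      (u (hmul g (hexp (L (φ n) • w))) - u g) / L (φ n) ≤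
        max (dot q w) (dot (P (φ n)) w) := by
    filter_upwards [hφ.tendsto_atTop.eventually hall] with n hn
    obtain ⟨hne, hin, hsubm⟩ := hn
    have h₁ := mul_dot_le_of_mem_hsub hpm w hin
    have h₂ := sub_le_mul_dot_of_mem_hsub hg hsubm
    rcases lt_or_gt_of_ne hne with hneg | hpos
    · exact ⟨min_le_of_right_le (by rw [le_div_iff_of_neg hneg, mul_comm]; exact h₂),
        le_max_of_le_left (by rw [div_le_iff_of_neg hneg, mul_comm]; exact h₁)⟩
    · exact ⟨min_le_of_left_le (by rw [le_div_iff₀ hpos, mul_comm]; exact h₁),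
        le_max_of_le_right (by rw [div_le_iff₀ hpos, mul_comm]; exact h₂)⟩
  exact tendsto_of_tendsto_of_tendsto_of_le_of_le' hmin hmax
    (hbd.mono fun _ h => h.1) (hbd.mono fun _ h => h.2)

theorem XdiffQuot_eq (u : Hgrp → ℝ) (g : Hgrp) :
    XdiffQuot u g = fun l => (u (hmul g (hexp (l • ((1, 0) : ℝ × ℝ)))) - u g) / l := by
  funext l
  simp [XdiffQuot, hexp]

theorem YdiffQuot_eq (u : Hgrp → ℝ) (g : Hgrp) :
    YdiffQuot u g = fun l => (u (hmul g (hexp (l • ((0, 1) : ℝ × ℝ)))) - u g) / l := by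
  funext l
  simp [YdiffQuot, hexp]

/-- for an H-convex `u`, both horizontal derivatives `Xu(g)`, `Yu(g)` exist
iff `∂_H u(g)` is a singleton; in either case `∂_H u(g) = {(Xu(g), Yu(g))}`. -/
theorem stmt5 (Ω : Set Hgrp) (hΩo : IsOpen Ω) (hΩc : HConvexSet Ω)
    (u : Hgrp → ℝ) (hu : HConvexOn Ω u) (g : Hgrp) (hg : g ∈ Ω) :
    ((XlimExists u g ∧ YlimExists u g) ↔ (∃ p : ℝ × ℝ, hsub Ω u g = {p})) ∧
    (∀ a b : ℝ,
      Filter.Tendsto (XdiffQuot u g) (nhdsWithin 0 {0}ᶜ) (nhds a) →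
      Filter.Tendsto (YdiffQuot u g) (nhdsWithin 0 {0}ᶜ) (nhds b) →
      hsub Ω u g = {(a, b)}) := by
  have hc := hu.convexOnHorizontalSegments
  have main : ∀ a b : ℝ,
      Filter.Tendsto (XdiffQuot u g) (nhdsWithin 0 {0}ᶜ) (nhds a) →
      Filter.Tendsto (YdiffQuot u g) (nhdsWithin 0 {0}ᶜ) (nhds b) →
      hsub Ω u g = {(a, b)} := by
    intro a b ha hb
    rw [XdiffQuot_eq] at ha
    rw [YdiffQuot_eq] at hb
    refine Set.eq_singleton_iff_nonempty_unique_mem.2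
      ⟨hc.hsub_nonempty hΩo hg, fun p hp => Prod.ext ?_ ?_⟩
    · simpa [dot] using dot_eq_of_mem_hsub_of_tendsto hΩo hg hp ha
    · simpa [dot] using dot_eq_of_mem_hsub_of_tendsto hΩo hg hp hb
  refine ⟨⟨?_, ?_⟩, main⟩
  · rintro ⟨⟨a, ha⟩, b, hb⟩
    exact ⟨(a, b), main a b ha hb⟩
  · rintro ⟨p, hp⟩
    refine ⟨⟨dot p (1, 0), ?_⟩, ⟨dot p (0, 1), ?_⟩⟩
    · rw [XdiffQuot_eq]
      exact hc.tendsto_of_hsub_eq_singleton hΩo hg hp (1, 0)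
    · rw [YdiffQuot_eq]
      exact hc.tendsto_of_hsub_eq_singleton hΩo hg hp (0, 1)
end
end

section
/- Let Ω ⊆ ℍ be open and u : Ω → ℝ be locally Lipschitz with respect to the Korányi distance ρ (every point of Ω has a neighborhood on which u is Lipschitz for ρ). Then for every compact set K ⊆ Ω, the set ∂_H u(K) is a compact subset of ℝ². -/
noncomputable section

open Filter Topology Set
open scoped ENNReal

/-- The Korányi distance from `g` to `g · exp v` is the Euclidean length of `v`. -/
theorem kdist_hmul_hexp (g : Hgrp) (v : ℝ × ℝ) : kdist g (hmul g (hexp v)) = enorm2 v := by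
  have h : kdist g (hmul g (hexp v)) = ((v.1 ^ 2 + v.2 ^ 2) ^ 2) ^ ((1:ℝ)/4) := by
    simp only [kdist, kgauge, hmul, hinv, hexp]
    congr 1
    ring
  rw [h, enorm2, Real.sqrt_eq_rpow, ← Real.rpow_natCast, ← Real.rpow_mul (by positivity)]
  norm_num

theorem kdist_self (g : Hgrp) : kdist g g = 0 := by
  have h : hmul (hinv g) g = (0, 0, 0) := by
    simp only [hmul, hinv, Prod.mk.injEq]
    refine ⟨by ring, by ring, by ring⟩
  rw [kdist, h]
  norm_num [kgauge]

theorem hmul_hexp_mem_hplane (g : Hgrp) (v : ℝ × ℝ) : hmul g (hexp v) ∈ hplane g := by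
  simp only [hmul, hexp, hplane, mem_ofPred_eq]
  ring

theorem continuous_kdist_right (g : Hgrp) : Continuous fun a => kdist a g := by
  simp only [kdist, kgauge, hmul, hinv]
  refine Continuous.rpow_const (by fun_prop) fun _ => Or.inr (by norm_num)

/-- A function that is locally Lipschitz for the Korányi distance is continuous. -/
theorem continuousOn_of_locally_kdist_lipschitz {Ω : Set Hgrp} {u : Hgrp → ℝ}
    (hlip : ∀ g ∈ Ω, ∃ V ∈ nhds g, ∃ L : ℝ, ∀ a ∈ V ∩ Ω, ∀ b ∈ V ∩ Ω,
      |u a - u b| ≤ L * kdist a b) : ContinuousOn u Ω := by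
  intro g hg
  obtain ⟨V, hV, L, h⟩ := hlip g hg
  refine tendsto_iff_dist_tendsto_zero.2 ?_
  have hlim : Tendsto (fun a => L * kdist a g) (𝓝[Ω] g) (𝓝 0) := by
    have := ((continuous_kdist_right g).const_mul L).tendsto g
    rw [kdist_self, mul_zero] at this
    exact this.mono_left nhdsWithin_le_nhds
  refine squeeze_zero' (Eventually.of_forall fun _ => dist_nonneg) ?_ hlim
  filter_upwards [mem_nhdsWithin_of_mem_nhds hV, self_mem_nhdsWithin] with a haV haΩ
  exact h a ⟨haV, haΩ⟩ g ⟨mem_of_mem_nhds hV, hg⟩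

/-- Subgradients pair with horizontal directions to at most the local Lipschitz constant. -/
theorem dot_le_of_mem_hsub {Ω U : Set Hgrp} {u : Hgrp → ℝ} {L : ℝ} (hU : IsOpen U) (hUΩ : U ⊆ Ω)
    (hL : ∀ a ∈ U, ∀ b ∈ U, |u a - u b| ≤ L * kdist a b) {g : Hgrp} (hg : g ∈ U) {p : ℝ × ℝ}
    (hp : p ∈ hsub Ω u g) (v : ℝ × ℝ) : dot p v ≤ L * enorm2 v := by
  have hc : Continuous fun s : ℝ => hmul g (hexp (s * v.1, s * v.2)) := by
    simp only [hmul, hexp]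
    fun_prop
  have h0 : hmul g (hexp (0 * v.1, 0 * v.2)) = g := by simp [hmul, hexp]
  have hev : ∀ᶠ s in 𝓝[>] (0:ℝ), hmul g (hexp (s * v.1, s * v.2)) ∈ U :=
    (hc.continuousAt.eventually_mem (hU.mem_nhds (h0.symm ▸ hg))).filter_mono nhdsWithin_le_nhds
  obtain ⟨s, hsU, hs⟩ := (hev.and self_mem_nhdsWithin).exists
  have hs0 : 0 < s := hs
  have h1 := hp _ ⟨hmul_hexp_mem_hplane g (s * v.1, s * v.2), hUΩ hsU⟩
  have h2 := hL g hg _ hsU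
  have hn : enorm2 (s * v.1, s * v.2) = s * enorm2 v := by
    simp only [enorm2]
    rw [show (s * v.1) ^ 2 + (s * v.2) ^ 2 = s ^ 2 * (v.1 ^ 2 + v.2 ^ 2) by ring,
      Real.sqrt_mul (sq_nonneg s), Real.sqrt_sq hs0.le]
  have hd : dot p (xi1 (hmul g (hexp (s * v.1, s * v.2))) - xi1 g) = s * dot p v := by
    simp only [dot, xi1, hmul, hexp, Prod.fst_sub, Prod.snd_sub]
    ring
  rw [kdist_hmul_hexp, hn] at h2
  rw [hd] at h1
  have h3 := neg_abs_le (u g - u (hmul g (hexp (s * v.1, s * v.2))))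
  refine le_of_mul_le_mul_left ?_ hs0
  linarith

theorem isBounded_hsubSet_of_kdist_lipschitz {Ω U : Set Hgrp} {u : Hgrp → ℝ} {L : ℝ}
    (hU : IsOpen U) (hUΩ : U ⊆ Ω) (hL : ∀ a ∈ U, ∀ b ∈ U, |u a - u b| ≤ L * kdist a b) :
    Bornology.IsBounded (hsubSet Ω u U) := by
  refine (Metric.isBounded_Icc ((-L, -L) : ℝ × ℝ) (L, L)).subset fun p hp => ?_
  obtain ⟨g, hg, hpg⟩ := mem_iUnion₂.1 hp
  have h := dot_le_of_mem_hsub hU hUΩ hL hg hpg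
  have h1 := h (1, 0)
  have h2 := h (-1, 0)
  have h3 := h (0, 1)
  have h4 := h (0, -1)
  norm_num [dot, enorm2] at h1 h2 h3 h4
  exact ⟨⟨by simp; linarith, by simp; linarith⟩, ⟨h1, h3⟩⟩

theorem isBounded_hsubSet {Ω : Set Hgrp} (hΩo : IsOpen Ω) {u : Hgrp → ℝ}
    (hlip : ∀ g ∈ Ω, ∃ V ∈ nhds g, ∃ L : ℝ, ∀ a ∈ V ∩ Ω, ∀ b ∈ V ∩ Ω,
      |u a - u b| ≤ L * kdist a b)
    {K : Set Hgrp} (hK : K ⊆ Ω) (hKc : IsCompact K) :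
    Bornology.IsBounded (hsubSet Ω u K) := by
  refine hKc.induction_on (p := fun S => Bornology.IsBounded (hsubSet Ω u S)) ?_ ?_ ?_ ?_
  · simp [hsubSet]
  · exact fun s t hst ht => ht.subset (biUnion_subset_biUnion_left hst)
  · intro s t hs ht
    simp only [hsubSet] at hs ht ⊢
    rw [biUnion_union]
    exact hs.union ht
  · intro g hg
    obtain ⟨V, hV, L, h⟩ := hlip g (hK hg)
    refine ⟨interior V ∩ Ω, mem_nhdsWithin_of_mem_nhds
      (inter_mem (interior_mem_nhds.2 hV) (hΩo.mem_nhds (hK hg))), ?_⟩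
    refine isBounded_hsubSet_of_kdist_lipschitz (isOpen_interior.inter hΩo) inter_subset_right
      (L := L) fun a ha b hb => ?_
    exact h a ⟨interior_subset ha.1, ha.2⟩ b ⟨interior_subset hb.1, hb.2⟩

/-- Over a closed subset of `Ω`, the graph of the H-subdifferential of a continuous function
is closed. -/
theorem isClosed_hsub_graph {Ω : Set Hgrp} (hΩo : IsOpen Ω) {u : Hgrp → ℝ}
    (hu : ContinuousOn u Ω) {K : Set Hgrp} (hK : K ⊆ Ω) (hKc : IsClosed K) :
    IsClosed {z : Hgrp × (ℝ × ℝ) | z.1 ∈ K ∧ z.2 ∈ hsub Ω u z.1} := by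
  refine IsSeqClosed.isClosed fun z w hz hw => ?_
  have hw1 : Tendsto (fun n => (z n).1) atTop (𝓝 w.1) := (continuous_fst.tendsto w).comp hw
  have hwK : w.1 ∈ K := hKc.mem_of_tendsto hw1 (Eventually.of_forall fun n => (hz n).1)
  refine ⟨hwK, fun q hq => ?_⟩
  have hcont : Continuous fun g : Hgrp =>
      ((q.1, q.2.1, g.2.2 + 2 * g.2.1 * q.1 - 2 * g.1 * q.2.1) : Hgrp) := by fun_prop
  have hqw : ((q.1, q.2.1, w.1.2.2 + 2 * w.1.2.1 * q.1 - 2 * w.1.1 * q.2.1) : Hgrp) = q :=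
    Prod.ext rfl (Prod.ext rfl hq.1.symm)
  have hlim := (hcont.tendsto w.1).comp hw1
  rw [hqw] at hlim
  have huq := (hu.continuousAt (hΩo.mem_nhds hq.2)).tendsto.comp hlim
  have huw := (hu.continuousAt (hΩo.mem_nhds (hK hwK))).tendsto.comp hw1
  have hdc : Continuous fun z : Hgrp × (ℝ × ℝ) => dot z.2 (xi1 q - xi1 z.1) := by
    simp only [dot, xi1, Prod.fst_sub, Prod.snd_sub]
    fun_prop
  refine le_of_tendsto_of_tendsto (huw.add ((hdc.tendsto w).comp hw)) huq ?_
  filter_upwards [hlim.eventually_mem (hΩo.mem_nhds hq.2)] with n hn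
  exact (hz n).2 _ ⟨rfl, hn⟩

/-- if `u` is locally Lipschitz for the Korányi distance on the open set
`Ω`, then `∂_H u(K)` is compact for every compact `K ⊆ Ω`. -/
theorem stmt9 (Ω : Set Hgrp) (hΩo : IsOpen Ω) (u : Hgrp → ℝ)
    (hlip : ∀ g ∈ Ω, ∃ V ∈ nhds g, ∃ L : ℝ, ∀ a ∈ V ∩ Ω, ∀ b ∈ V ∩ Ω,
      |u a - u b| ≤ L * kdist a b)
    (K : Set Hgrp) (hK : K ⊆ Ω) (hKc : IsCompact K) :
    IsCompact (hsubSet Ω u K) := by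
  have hb := isBounded_hsubSet hΩo hlip hK hKc
  have hcl := isClosed_hsub_graph hΩo (continuousOn_of_locally_kdist_lipschitz hlip) hK
    hKc.isClosed
  have hgraph : IsCompact {z : Hgrp × (ℝ × ℝ) | z.1 ∈ K ∧ z.2 ∈ hsub Ω u z.1} :=
    (hKc.prod hb.isCompact_closure).of_isClosed_subset hcl fun z hz =>
      ⟨hz.1, subset_closure (mem_iUnion₂.2 ⟨z.1, hz.1, hz.2⟩)⟩
  have himage : hsubSet Ω u K =
      Prod.snd '' {z : Hgrp × (ℝ × ℝ) | z.1 ∈ K ∧ z.2 ∈ hsub Ω u z.1} := by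
    ext p
    simp [hsubSet]
  rw [himage]
  exact hgraph.image continuous_snd
end
end
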